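/- arXiv:1004.4133 — 3 statements merged into one kernel-verified Lean document; each statement's English description precedes it below -/
import Mathlib

section
/- Let ℓ ≥ 33 be an integer and q = e^{iπ/ℓ}. Then [20]_q[24]_q[31]_q/([6]_q[10]_q) is not a (rational) integer. -/
/-- The quantum integer `[n]_q = (q^n - q^{-n})/(q - q^{-1})`. -/
noncomputable def qint (q : ℂ) (n : ℕ) : ℂ :=
  (q ^ (n : ℤ) - q ^ (-(n : ℤ))) / (q - q⁻¹)

open Polynomial in
/-- An integer polynomial vanishing at a primitive root of unity vanishes at all its conjugates. -/
theorem IsPrimitiveRoot.aeval_pow_eq_zero {x : ℂ} {n j : ℕ} (hx : IsPrimitiveRoot x n)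
    (hn : 0 < n) (hj : j.Coprime n) {F : ℤ[X]} (hF : aeval x F = 0) : aeval (x ^ j) F = 0 := by
  have hdvd : minpoly ℤ x ∣ F := minpoly.isIntegrallyClosed_dvd (hx.isIntegral hn) hF
  rw [hx.minpoly_eq_pow_coprime hj] at hdvd
  exact aeval_eq_zero_of_dvd_aeval_eq_zero hdvd (minpoly.aeval _ _)

theorem exp_mul_I_pow_sub_one (t : ℝ) (n : ℕ) :
    (Complex.exp (t * Complex.I) ^ 2) ^ n - 1 =
      2 * Complex.I * Complex.exp (t * Complex.I) ^ n * (Real.sin (n * t) : ℝ) := by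
  rw [Complex.ofReal_sin, Complex.sin, Complex.ofReal_mul, Complex.ofReal_natCast, neg_mul,
    Complex.exp_neg, mul_assoc (n : ℂ), Complex.exp_nat_mul]
  have h : Complex.exp (t * Complex.I) ≠ 0 := Complex.exp_ne_zero _
  field_simp
  rw [Complex.I_sq]
  ring

theorem qint_ratio_root_iff_sin (t : ℝ) (k : ℤ) :
    ((Complex.exp (t * Complex.I) ^ 2) ^ 20 - 1) * ((Complex.exp (t * Complex.I) ^ 2) ^ 24 - 1) *
      ((Complex.exp (t * Complex.I) ^ 2) ^ 31 - 1) =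
    k * (Complex.exp (t * Complex.I) ^ 2) ^ 29 * ((Complex.exp (t * Complex.I) ^ 2) ^ 6 - 1) *
      ((Complex.exp (t * Complex.I) ^ 2) ^ 10 - 1) * ((Complex.exp (t * Complex.I) ^ 2) ^ 1 - 1) ↔
    Real.sin (20 * t) * Real.sin (24 * t) * Real.sin (31 * t) =
      k * Real.sin (6 * t) * Real.sin (10 * t) * Real.sin t := by
  simp only [exp_mul_I_pow_sub_one]
  have h : Complex.exp (t * Complex.I) ≠ 0 := Complex.exp_ne_zero _
  generalize Complex.exp (t * Complex.I) = w at h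
  have hc : (2 * Complex.I) ^ 3 * w ^ 75 ≠ 0 := by simp [h]
  constructor <;> intro e
  · rw [← Complex.ofReal_inj]
    refine mul_left_cancel₀ hc ?_
    push_cast at e ⊢
    rw [one_mul] at e
    linear_combination e
  · have e' := congrArg Complex.ofReal e
    push_cast at e' ⊢
    rw [one_mul]
    linear_combination (2 * Complex.I) ^ 3 * w ^ 75 * e'

/-- The equation between sines passes from `π / ℓ` to its multiples by integers prime to `ℓ`. -/
theorem sin_eq_of_coprime {ℓ j : ℕ} (hℓ : 0 < ℓ) (hj : j.Coprime ℓ) {k : ℤ} {θ : ℝ}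
    (hθ : θ = Real.pi / ℓ)
    (h : Real.sin (20 * θ) * Real.sin (24 * θ) * Real.sin (31 * θ) =
      k * Real.sin (6 * θ) * Real.sin (10 * θ) * Real.sin θ) :
    Real.sin (20 * (j * θ)) * Real.sin (24 * (j * θ)) * Real.sin (31 * (j * θ)) =
      k * Real.sin (6 * (j * θ)) * Real.sin (10 * (j * θ)) * Real.sin (j * θ) := by
  open Polynomial in
  have hx : IsPrimitiveRoot (Complex.exp (θ * Complex.I) ^ 2) ℓ := by
    have := Complex.isPrimitiveRoot_exp ℓ hℓ.ne'
    rw [← Complex.exp_nat_mul]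
    convert this using 2
    rw [hθ]
    push_cast
    ring
  rw [← qint_ratio_root_iff_sin] at h ⊢
  have hpow : Complex.exp ((j * θ : ℝ) * Complex.I) ^ 2 =
      (Complex.exp (θ * Complex.I) ^ 2) ^ j := by
    rw [← pow_mul, mul_comm 2 j, pow_mul, ← Complex.exp_nat_mul _ j]
    push_cast
    ring_nf
  rw [hpow]
  have key := hx.aeval_pow_eq_zero hℓ hj
    (F := (X ^ 20 - 1) * (X ^ 24 - 1) * (X ^ 31 - 1) -
      C k * X ^ 29 * (X ^ 6 - 1) * (X ^ 10 - 1) * (X ^ 1 - 1))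
  simp only [map_sub, map_mul, map_pow, aeval_X, map_one, aeval_C, sub_eq_zero] at key
  exact key h

theorem abs_cos_le_cos {a b : ℝ} (ha : 0 ≤ a) (hab : a ≤ b) (hb : a + b ≤ Real.pi) :
    |Real.cos b| ≤ Real.cos a := by
  rw [abs_le]
  constructor
  · rw [← Real.cos_pi_sub]
    exact Real.cos_le_cos_of_nonneg_of_le_pi (by linarith) (by linarith) (by linarith)
  · exact Real.cos_le_cos_of_nonneg_of_le_pi ha (by linarith) hab

theorem abs_cos_lt_cos {a b : ℝ} (ha : 0 ≤ a) (hab : a < b) (hb : a + b < Real.pi) :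
    |Real.cos b| < Real.cos a := by
  rw [abs_lt]
  constructor
  · rw [← Real.cos_pi_sub]
    exact Real.cos_lt_cos_of_nonneg_of_le_pi (by linarith) (by linarith) (by linarith)
  · exact Real.cos_lt_cos_of_nonneg_of_le_pi ha (by linarith) hab

theorem sin_lt_sin_of_add_lt_pi {a b : ℝ} (ha : 0 ≤ a) (hab : a < b) (hb : a + b < Real.pi) :
    Real.sin a < Real.sin b := by
  have h1 : 0 < Real.sin ((b - a) / 2) :=
    Real.sin_pos_of_pos_of_lt_pi (by linarith) (by linarith)
  have h2 : 0 < Real.cos ((a + b) / 2) := Real.cos_pos_of_mem_Ioo ⟨by linarith, by linarith⟩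
  have h3 := Real.sin_sub_sin b a
  rw [add_comm b a] at h3
  nlinarith [mul_pos h1 h2]

theorem sin_eq_of_qint_ratio {θ : ℝ} {k : ℤ} {q : ℂ}
    (hq : q = Complex.exp (θ * Complex.I)) (hs : ∀ c : ℝ, 0 < c → c < 33 → 0 < Real.sin (c * θ))
    (hk : qint q 20 * qint q 24 * qint q 31 / (qint q 6 * qint q 10) = (k : ℂ)) :
    Real.sin (20 * θ) * Real.sin (24 * θ) * Real.sin (31 * θ) =
      k * Real.sin (6 * θ) * Real.sin (10 * θ) * Real.sin θ := by
  have hq0 : q ≠ 0 := hq ▸ Complex.exp_ne_zero _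
  have hsub (n : ℕ) : q ^ (n : ℤ) - q ^ (-(n : ℤ)) = 2 * Complex.I * (Real.sin (n * θ) : ℝ) := by
    have := exp_mul_I_pow_sub_one θ n
    rw [← hq] at this
    rw [zpow_neg, zpow_natCast]
    have hn : q ^ n ≠ 0 := pow_ne_zero _ hq0
    field_simp
    linear_combination this
  have hden : q - q⁻¹ = 2 * Complex.I * (Real.sin θ : ℝ) := by simpa using hsub 1
  have h1 := hs 1 (by norm_num) (by norm_num)
  have h6 := hs 6 (by norm_num) (by norm_num)
  have h10 := hs 10 (by norm_num) (by norm_num)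
  rw [one_mul] at h1
  have hI : 2 * Complex.I ≠ 0 := by simp
  have hqint (n : ℕ) : qint q n = ((Real.sin (n * θ) / Real.sin θ : ℝ) : ℂ) := by
    rw [qint, hsub, hden, mul_div_mul_left _ _ hI, Complex.ofReal_div]
  simp only [hqint] at hk
  have hk' : Real.sin (20 * θ) / Real.sin θ * (Real.sin (24 * θ) / Real.sin θ) *
      (Real.sin (31 * θ) / Real.sin θ) /
      (Real.sin (6 * θ) / Real.sin θ * (Real.sin (10 * θ) / Real.sin θ)) = k := by
    exact_mod_cast hk
  generalize Real.sin (6 * θ) = s₆, Real.sin (10 * θ) = s₁₀ at *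
  generalize Real.sin (20 * θ) = s₂₀, Real.sin (24 * θ) = s₂₄, Real.sin (31 * θ) = s₃₁ at *
  field_simp at hk'
  linear_combination hk'

theorem sin_eq_false_of_two_mul {θ : ℝ} {k : ℤ} (h0 : 0 < θ) (h32 : 32 * θ < Real.pi)
    (hs : ∀ c : ℝ, 0 < c → c < 33 → 0 < Real.sin (c * θ))
    (h : Real.sin (20 * θ) * Real.sin (24 * θ) * Real.sin (31 * θ) =
      k * Real.sin (6 * θ) * Real.sin (10 * θ) * Real.sin θ)
    (h' : Real.sin (20 * (2 * θ)) * Real.sin (24 * (2 * θ)) * Real.sin (31 * (2 * θ)) =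
      k * Real.sin (6 * (2 * θ)) * Real.sin (10 * (2 * θ)) * Real.sin (2 * θ)) : False := by
  have hd (c : ℝ) : Real.sin (c * (2 * θ)) = 2 * Real.sin (c * θ) * Real.cos (c * θ) := by
    rw [← Real.sin_two_mul]; ring_nf
  rw [hd, hd, hd, hd, hd, Real.sin_two_mul] at h'
  have h20 := hs 20 (by norm_num) (by norm_num)
  have h24 := hs 24 (by norm_num) (by norm_num)
  have h31 := hs 31 (by norm_num) (by norm_num)
  have e : Real.cos (20 * θ) * Real.cos (24 * θ) * Real.cos (31 * θ) =
      Real.cos (10 * θ) * Real.cos (6 * θ) * Real.cos θ := by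
    refine mul_left_cancel₀ (mul_pos (mul_pos h20 h24) h31).ne' ?_
    linear_combination h' / 8 + Real.cos (10 * θ) * Real.cos (6 * θ) * Real.cos θ * (-h)
  have c10 := abs_cos_le_cos (a := 10 * θ) (b := 20 * θ) (by linarith) (by linarith) (by linarith)
  have c6 := abs_cos_le_cos (a := 6 * θ) (b := 24 * θ) (by linarith) (by linarith) (by linarith)
  have c1 := abs_cos_lt_cos (a := θ) (b := 31 * θ) (by linarith) (by linarith) (by linarith)
  have p10 : 0 < Real.cos (10 * θ) := Real.cos_pos_of_mem_Ioo ⟨by linarith, by linarith⟩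
  have p6 : 0 < Real.cos (6 * θ) := Real.cos_pos_of_mem_Ioo ⟨by linarith, by linarith⟩
  have := calc
    |Real.cos (20 * θ) * Real.cos (24 * θ) * Real.cos (31 * θ)|
      = |Real.cos (20 * θ)| * |Real.cos (24 * θ)| * |Real.cos (31 * θ)| := by simp only [abs_mul]
    _ ≤ Real.cos (10 * θ) * Real.cos (6 * θ) * |Real.cos (31 * θ)| := by gcongr
    _ < Real.cos (10 * θ) * Real.cos (6 * θ) * Real.cos θ := by gcongr
  rw [← e] at this
  exact absurd (le_abs_self _) this.not_ge

theorem sin_eq_false_of_pi_div_two_add_two_mul {θ : ℝ} {k : ℤ} (h0 : 0 < θ)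
    (h34 : 34 * θ ≤ Real.pi) (hs : ∀ c : ℝ, 0 < c → c < 33 → 0 < Real.sin (c * θ))
    (h : Real.sin (20 * θ) * Real.sin (24 * θ) * Real.sin (31 * θ) =
      k * Real.sin (6 * θ) * Real.sin (10 * θ) * Real.sin θ)
    (h' : Real.sin (20 * (2 * θ)) * Real.sin (24 * (2 * θ)) * Real.cos (31 * (2 * θ)) =
      -(k * Real.sin (6 * (2 * θ)) * Real.sin (10 * (2 * θ)) * Real.cos (2 * θ))) : False := by
  have hd (c : ℝ) : Real.sin (c * (2 * θ)) = 2 * Real.sin (c * θ) * Real.cos (c * θ) := by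
    rw [← Real.sin_two_mul]; ring_nf
  rw [hd, hd, hd, hd] at h'
  have h20 := hs 20 (by norm_num) (by norm_num)
  have h24 := hs 24 (by norm_num) (by norm_num)
  have h1 := hs 1 (by norm_num) (by norm_num)
  rw [one_mul] at h1
  have e : Real.cos (20 * θ) * Real.cos (24 * θ) * (Real.cos (31 * (2 * θ)) * Real.sin θ) =
      -(Real.cos (10 * θ) * Real.cos (6 * θ) * (Real.sin (31 * θ) * Real.cos (2 * θ))) := by
    refine mul_left_cancel₀ (mul_pos h20 h24).ne' ?_
    linear_combination h' * Real.sin θ / 4 +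
      Real.cos (10 * θ) * Real.cos (6 * θ) * Real.cos (2 * θ) * h
  have c10 := abs_cos_le_cos (a := 10 * θ) (b := 20 * θ) (by linarith) (by linarith) (by linarith)
  have c6 := abs_cos_le_cos (a := 6 * θ) (b := 24 * θ) (by linarith) (by linarith) (by linarith)
  have p10 : 0 < Real.cos (10 * θ) := Real.cos_pos_of_mem_Ioo ⟨by linarith, by linarith⟩
  have p6 : 0 < Real.cos (6 * θ) := Real.cos_pos_of_mem_Ioo ⟨by linarith, by linarith⟩
  have p2 : 0 < Real.cos (2 * θ) := Real.cos_pos_of_mem_Ioo ⟨by linarith, by linarith⟩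
  have s31 : Real.sin (3 * θ) ≤ Real.sin (31 * θ) := by
    rcases h34.eq_or_lt with h34 | h34
    · rw [← Real.sin_pi_sub, ← h34]
      ring_nf
      rfl
    · exact (sin_lt_sin_of_add_lt_pi (by linarith) (by linarith) (by linarith)).le
  have s5 : Real.sin θ < Real.sin (5 * θ) :=
    sin_lt_sin_of_add_lt_pi (by linarith) (by linarith) (by linarith)
  have s3 : Real.sin θ < Real.sin (3 * θ) * Real.cos (2 * θ) := by
    have e5 := Real.sin_add (3 * θ) (2 * θ)
    have e1 := Real.sin_sub (3 * θ) (2 * θ)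
    rw [show 3 * θ + 2 * θ = 5 * θ by ring] at e5
    rw [show 3 * θ - 2 * θ = θ by ring] at e1
    linarith
  have c1 : |Real.cos (31 * (2 * θ)) * Real.sin θ| < Real.sin (31 * θ) * Real.cos (2 * θ) := calc
    |Real.cos (31 * (2 * θ)) * Real.sin θ| = |Real.cos (31 * (2 * θ))| * Real.sin θ := by
      rw [abs_mul, abs_of_pos h1]
    _ ≤ 1 * Real.sin θ := by gcongr; exact Real.abs_cos_le_one _
    _ < Real.sin (3 * θ) * Real.cos (2 * θ) := by rwa [one_mul]
    _ ≤ Real.sin (31 * θ) * Real.cos (2 * θ) := by gcongr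
  have := calc
    |Real.cos (20 * θ) * Real.cos (24 * θ) * (Real.cos (31 * (2 * θ)) * Real.sin θ)|
      = |Real.cos (20 * θ)| * |Real.cos (24 * θ)| *
          |Real.cos (31 * (2 * θ)) * Real.sin θ| := by rw [abs_mul, abs_mul]
    _ ≤ Real.cos (10 * θ) * Real.cos (6 * θ) * |Real.cos (31 * (2 * θ)) * Real.sin θ| := by gcongr
    _ < Real.cos (10 * θ) * Real.cos (6 * θ) * (Real.sin (31 * θ) * Real.cos (2 * θ)) := by gcongr
  rw [e, abs_neg] at this
  exact absurd (le_abs_self _) this.not_ge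

theorem sin_eq_false_of_pi_div_two_add {θ : ℝ} {k : ℤ}
    (hs : ∀ c : ℝ, 0 < c → c < 33 → 0 < Real.sin (c * θ))
    (h : Real.sin (20 * θ) * Real.sin (24 * θ) * Real.sin (31 * θ) =
      k * Real.sin (6 * θ) * Real.sin (10 * θ) * Real.sin θ)
    (h' : Real.sin (20 * θ) * Real.sin (24 * θ) * Real.cos (31 * θ) =
      -(k * Real.sin (6 * θ) * Real.sin (10 * θ) * Real.cos θ)) : False := by
  have h20 := hs 20 (by norm_num) (by norm_num)
  have h24 := hs 24 (by norm_num) (by norm_num)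
  have h32 := hs 32 (by norm_num) (by norm_num)
  rw [show 32 * θ = 31 * θ + θ by ring, Real.sin_add] at h32
  refine (mul_pos (mul_pos h20 h24) h32).ne' ?_
  linear_combination Real.cos θ * h + Real.sin θ * h'

/-- Translation of the equation between sines by a quarter period. -/
theorem sin_eq_pi_div_two_add {t : ℝ} {k : ℤ}
    (h : Real.sin (20 * (Real.pi / 2 + t)) * Real.sin (24 * (Real.pi / 2 + t)) *
        Real.sin (31 * (Real.pi / 2 + t)) =
      k * Real.sin (6 * (Real.pi / 2 + t)) * Real.sin (10 * (Real.pi / 2 + t)) *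
        Real.sin (Real.pi / 2 + t)) :
    Real.sin (20 * t) * Real.sin (24 * t) * Real.cos (31 * t) =
      -(k * Real.sin (6 * t) * Real.sin (10 * t) * Real.cos t) := by
  rw [show 20 * (Real.pi / 2 + t) = 20 * t + (5 : ℕ) * (2 * Real.pi) by push_cast; ring,
    show 24 * (Real.pi / 2 + t) = 24 * t + (6 : ℕ) * (2 * Real.pi) by push_cast; ring,
    show 31 * (Real.pi / 2 + t) = 31 * t + Real.pi / 2 + Real.pi + (7 : ℕ) * (2 * Real.pi) by
      push_cast; ring,
    show 6 * (Real.pi / 2 + t) = 6 * t + Real.pi + (1 : ℕ) * (2 * Real.pi) by push_cast; ring,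
    show 10 * (Real.pi / 2 + t) = 10 * t + Real.pi + (2 : ℕ) * (2 * Real.pi) by push_cast; ring,
    add_comm (Real.pi / 2) t] at h
  simp only [Real.sin_add_nat_mul_two_pi, Real.sin_add_pi, Real.sin_add_pi_div_two] at h
  linear_combination -h

/-- For `ℓ ≥ 33` and `q = e^{iπ/ℓ}`, the quantity `[20]_q[24]_q[31]_q/([6]_q[10]_q)`
is not a rational integer. -/
theorem stmt_6 (ℓ : ℕ) (hℓ : 33 ≤ ℓ)
    (q : ℂ) (hq : q = Complex.exp (Real.pi * Complex.I / (ℓ : ℂ))) :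
    ¬ ∃ k : ℤ, qint q 20 * qint q 24 * qint q 31 / (qint q 6 * qint q 10) = (k : ℂ) := by
  rintro ⟨k, hk⟩
  have hℓ' : (33 : ℝ) ≤ ℓ := by exact_mod_cast hℓ
  obtain ⟨θ, hθ⟩ : ∃ θ : ℝ, θ = Real.pi / ℓ := ⟨_, rfl⟩
  have hmul : ℓ * θ = Real.pi := by rw [hθ]; field_simp
  have h0 : 0 < θ := hθ ▸ div_pos Real.pi_pos (by linarith)
  have h33 : 33 * θ ≤ Real.pi := by rw [← hmul]; gcongr
  have hs (c : ℝ) (hc : 0 < c) (hc' : c < 33) : 0 < Real.sin (c * θ) :=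
    Real.sin_pos_of_pos_of_lt_pi (by positivity) (by nlinarith)
  have hq' : q = Complex.exp (θ * Complex.I) := by
    rw [hq, hθ]
    push_cast
    ring_nf
  have h := sin_eq_of_qint_ratio hq' hs hk
  have hpos : 0 < ℓ := by omega
  rcases Nat.even_or_odd ℓ with ⟨m, hm⟩ | hodd
  · have hmθ : m * θ = Real.pi / 2 := by
      rw [← hmul, hm]
      push_cast
      ring
    rcases Nat.even_or_odd m with hm2 | hm2
    · have hj : (m + 1).Coprime ℓ := by
        rw [hm, ← two_mul]
        exact Nat.Coprime.mul_right (Nat.coprime_two_right.2 hm2.add_one) (by simp)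
      have h' := sin_eq_of_coprime hpos hj hθ h
      rw [show ((m + 1 : ℕ) : ℝ) * θ = Real.pi / 2 + θ by push_cast; linarith] at h'
      exact sin_eq_false_of_pi_div_two_add hs h (sin_eq_pi_div_two_add h')
    · have hj : (m + 2).Coprime ℓ := by
        rw [hm, ← two_mul]
        exact Nat.Coprime.mul_right (Nat.coprime_two_right.2 (hm2.add_even even_two))
          (by simpa using hm2)
      have h' := sin_eq_of_coprime hpos hj hθ h
      rw [show ((m + 2 : ℕ) : ℝ) * θ = Real.pi / 2 + 2 * θ by push_cast; linarith] at h'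
      have h34 : 34 * θ ≤ Real.pi := by
        rw [← hmul]
        gcongr
        exact_mod_cast (by omega : 34 ≤ ℓ)
      exact sin_eq_false_of_pi_div_two_add_two_mul h0 h34 hs h (sin_eq_pi_div_two_add h')
  · have h' := sin_eq_of_coprime hpos (Nat.coprime_two_left.2 hodd) hθ h
    exact sin_eq_false_of_two_mul h0 (by linarith) hs h h'
end

section
/- Let ℓ ≥ 10 be an even integer and q = e^{iπ/ℓ}. If [3]_q[8]_q[13]_q[18]_q/([4]_q[6]_q[9]_q) is a (rational) integer, then ℓ ≤ 66. -/
open Polynomial in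
theorem totient_le_of_monic_root {n : ℕ} (hn : 0 < n) {w : ℂ} (hw : IsPrimitiveRoot w n)
    {P : ℤ[X]} (hP : P.Monic) (hroot : aeval w P = 0) : n.totient ≤ P.natDegree :=
  hw.totient_le_degree_minpoly.trans <|
    natDegree_le_of_dvd (minpoly.isIntegrallyClosed_dvd (hw.isIntegral hn) hroot) hP.ne_zero

/-- Eight times a multiplicative function of `n`; it bounds `8 * n ^ 2 / φ(n) ^ 3` from above and
depends only on divisibility of `n` by `2` and `3`. -/
def totientWeight (n : ℕ) : ℕ :=
  (if 2 ∣ n then 4 else 1) * (if 3 ∣ n then 9 else 8)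

theorem totientWeight_mul {a b : ℕ} (hab : a.Coprime b) :
    totientWeight a * totientWeight b = 8 * totientWeight (a * b) := by
  have h2 : ¬(2 ∣ a ∧ 2 ∣ b) := fun h => Nat.not_coprime_of_dvd_of_dvd one_lt_two h.1 h.2 hab
  have h3 : ¬(3 ∣ a ∧ 3 ∣ b) := fun h =>
    Nat.not_coprime_of_dvd_of_dvd (by norm_num) h.1 h.2 hab
  simp only [totientWeight, Nat.prime_two.dvd_mul, Nat.prime_three.dvd_mul]
  by_cases h2a : 2 ∣ a <;> by_cases h2b : 2 ∣ b <;> by_cases h3a : 3 ∣ a <;>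
    by_cases h3b : 3 ∣ b <;> simp [h2a, h2b, h3a, h3b] at h2 h3 ⊢

theorem prime_weight {p : ℕ} (hp : p.Prime) :
    8 * p ^ 2 ≤ totientWeight p * (p - 1) ^ 3 := by
  obtain h | h := lt_or_ge p 5
  · have := hp.two_le
    interval_cases p
    · decide
    · decide
    · exact absurd hp (by norm_num)
  · obtain ⟨r, rfl⟩ := Nat.exists_eq_add_of_le h
    have hw : 8 ≤ totientWeight (5 + r) := by
      unfold totientWeight
      split_ifs <;> norm_num
    rw [show 5 + r - 1 = r + 4 by omega]
    exact Nat.mul_le_mul hw (by nlinarith [Nat.zero_le (r ^ 3), Nat.zero_le (r ^ 2)])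

theorem eight_mul_sq_le_totientWeight_mul (n : ℕ) :
    8 * n ^ 2 ≤ totientWeight n * n.totient ^ 3 := by
  induction n using Nat.recOnPosPrimePosCoprime with
  | prime_pow p k hp hk =>
    have hw : totientWeight (p ^ k) = totientWeight p := by
      simp only [totientWeight, Nat.prime_two.prime.dvd_pow_iff_dvd hk.ne',
        Nat.prime_three.prime.dvd_pow_iff_dvd hk.ne']
    rw [hw, Nat.totient_prime_pow hp hk]
    obtain ⟨j, rfl⟩ := Nat.exists_eq_add_of_lt hk
    simp only [zero_add, Nat.add_sub_cancel, pow_succ _ j]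
    have hx : (p ^ j) ^ 2 ≤ (p ^ j) ^ 3 :=
      Nat.pow_le_pow_right (Nat.pow_pos hp.pos) (by norm_num)
    calc 8 * (p ^ j * p) ^ 2 = (p ^ j) ^ 2 * (8 * p ^ 2) := by ring
      _ ≤ (p ^ j) ^ 3 * (totientWeight p * (p - 1) ^ 3) := Nat.mul_le_mul hx (prime_weight hp)
      _ = totientWeight p * (p ^ j * (p - 1)) ^ 3 := by ring
  | zero => simp
  | one => decide
  | coprime a b _ _ hab iha ihb =>
    rw [Nat.totient_mul hab]
    refine Nat.le_of_mul_le_mul_left (c := 8) ?_ (by norm_num)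
    calc 8 * (8 * (a * b) ^ 2) = 8 * a ^ 2 * (8 * b ^ 2) := by ring
      _ ≤ _ := Nat.mul_le_mul iha ihb
      _ = totientWeight a * totientWeight b * (a.totient * b.totient) ^ 3 := by ring
      _ = _ := by rw [totientWeight_mul hab]; ring

theorem le_of_even_of_totient_le {n : ℕ} (heven : Even n) (hn : n.totient ≤ 22) : n ≤ 66 := by
  obtain ⟨m, rfl⟩ := heven
  have hm : m < 110 := by
    have hw : totientWeight (m + m) ≤ 36 := by
      unfold totientWeight
      split_ifs <;> norm_num
    have h := (eight_mul_sq_le_totientWeight_mul (m + m)).trans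
      (Nat.mul_le_mul hw (Nat.pow_le_pow_left hn 3))
    nlinarith
  have key : ∀ m < 110, (m + m).totient ≤ 22 → m + m ≤ 66 := by decide +kernel
  exact key m hm hn

theorem qint_eq_div {q : ℂ} (hq : q ≠ 0) (h : q ^ 2 - 1 ≠ 0) (n : ℕ) :
    qint q n = q * ((q ^ 2) ^ n - 1) / ((q ^ 2 - 1) * q ^ n) := by
  have h1 : q - q⁻¹ ≠ 0 := by
    intro h0
    apply h
    field_simp at h0
    linear_combination h0
  rw [qint, zpow_neg, zpow_natCast]
  field_simp
  ring

open Polynomial in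
/-- A polynomial with root `q ^ 2` whenever the quotient of quantum integers equals `k`. -/
noncomputable def quotientPoly (k : ℤ) : ℤ[X] :=
  (X ^ 4 + 1) * (X ^ 6 - X ^ 3 + 1) * (∑ i ∈ Finset.range 13, X ^ i) - C k * X ^ 11

theorem quotientPoly_natDegree (k : ℤ) : (quotientPoly k).natDegree = 22 := by
  rw [quotientPoly]
  simp only [Finset.sum_range_succ, Finset.sum_range_zero]
  compute_degree!

theorem quotientPoly_monic (k : ℤ) : (quotientPoly k).Monic := by
  rw [Polynomial.Monic, Polynomial.leadingCoeff, quotientPoly_natDegree, quotientPoly]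
  simp only [Finset.sum_range_succ, Finset.sum_range_zero]
  compute_degree!

/-- For even `ℓ ≥ 10` and `q = e^{iπ/ℓ}`, if `[3]_q[8]_q[13]_q[18]_q/([4]_q[6]_q[9]_q)`
is a rational integer then `ℓ ≤ 66`. -/
theorem stmt_7 (ℓ : ℕ) (hℓ : 10 ≤ ℓ) (heven : Even ℓ)
    (q : ℂ) (hq : q = Complex.exp (Real.pi * Complex.I / (ℓ : ℂ)))
    (k : ℤ)
    (hk : qint q 3 * qint q 8 * qint q 13 * qint q 18 /
      (qint q 4 * qint q 6 * qint q 9) = (k : ℂ)) :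
    ℓ ≤ 66 := by
  have hq0 : q ≠ 0 := hq ▸ Complex.exp_ne_zero _
  have hw : IsPrimitiveRoot (q ^ 2) ℓ := by
    have h := Complex.isPrimitiveRoot_exp ℓ (by omega)
    rwa [show q ^ 2 = Complex.exp (2 * Real.pi * Complex.I / ℓ) by
      rw [hq, ← Complex.exp_nat_mul]; congr 1; push_cast; ring]
  have hne : ∀ n : ℕ, 0 < n → n < 10 → (q ^ 2) ^ n - 1 ≠ 0 := fun n h0 h1 =>
    sub_ne_zero.mpr (hw.pow_ne_one_of_pos_of_lt h0.ne' (by omega))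
  have h1 := hne 1 (by norm_num) (by norm_num)
  have h4 := hne 4 (by norm_num) (by norm_num)
  have h6 := hne 6 (by norm_num) (by norm_num)
  have h9 := hne 9 (by norm_num) (by norm_num)
  rw [pow_one] at h1
  have hroot : Polynomial.aeval (q ^ 2) (quotientPoly k) = 0 := by
    simp only [qint_eq_div hq0 h1] at hk
    have hq22 : q ^ 22 = (q ^ 2) ^ 11 := by ring
    generalize q ^ 2 = w at *
    have hk' : (w ^ 3 - 1) * (w ^ 8 - 1) * (w ^ 13 - 1) * (w ^ 18 - 1) =
        k * (w - 1) * w ^ 11 * ((w ^ 4 - 1) * (w ^ 6 - 1) * (w ^ 9 - 1)) := by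
      rw [← hq22]
      field_simp at hk
      linear_combination hk
    have hcancel : (w - 1) * (w ^ 4 - 1) * (w ^ 6 - 1) * (w ^ 9 - 1) ≠ 0 := by
      simp [h1, h4, h6, h9]
    refine (mul_eq_zero.mp ?_).resolve_left hcancel
    simp only [quotientPoly, Finset.sum_range_succ, Finset.sum_range_zero, map_sub, map_mul,
      map_add, map_pow, map_one, Polynomial.aeval_X, map_zero,
      eq_intCast, map_intCast]
    linear_combination hk'
  exact le_of_even_of_totient_le heven <|
    (totient_le_of_monic_root (by omega) hw (quotientPoly_monic k) hroot).trans_eq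
      (quotientPoly_natDegree k)
end

section
/- Let ℓ ≥ 5 be an odd integer and q = e^{iπ/ℓ}. If [13]_q[8]_q/[4]_q is a (rational) integer, then ℓ ≤ 51. -/
open Polynomial in
/-- A primitive `n`-th root of unity is a root of no nonzero integer polynomial of degree
less than `φ(n)`. -/
theorem IsPrimitiveRoot.totient_le_natDegree_of_aeval_eq_zero {n : ℕ} (hn : 0 < n) {w : ℂ}
    (hw : IsPrimitiveRoot w n) {p : ℤ[X]} (hp : p ≠ 0) (h : aeval w p = 0) :
    n.totient ≤ p.natDegree :=
  hw.totient_le_degree_minpoly.trans <| natDegree_le_of_dvd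
    (minpoly.isIntegrallyClosed_dvd (hw.isIntegral hn) h) hp

theorem Nat.le_totient_sq_of_odd {n : ℕ} (hn : Odd n) : n ≤ n.totient ^ 2 := by
  induction n using Nat.recOnPosPrimePosCoprime with
  | zero => simp
  | one => simp
  | prime_pow p k hp hk =>
    have h3 : 3 ≤ p := by
      have h2 := hp.two_le
      have hpodd : Odd p := Odd.of_dvd_nat hn (dvd_pow_self p hk.ne')
      grind
    obtain ⟨m, rfl⟩ := Nat.exists_eq_succ_of_ne_zero hk.ne'
    rw [Nat.totient_prime_pow_succ hp, pow_succ, mul_pow]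
    obtain ⟨r, rfl⟩ := Nat.exists_eq_add_of_le' h3
    refine Nat.mul_le_mul (Nat.le_self_pow two_ne_zero _) ?_
    rw [show r + 3 - 1 = r + 2 by omega]
    nlinarith
  | coprime a b _ _ hab iha ihb =>
    rw [Nat.odd_mul] at hn
    rw [Nat.totient_mul hab, mul_pow]
    exact Nat.mul_le_mul (iha hn.1) (ihb hn.2)

theorem Nat.le_of_odd_of_totient_le_sixteen {n : ℕ} (hn : Odd n) (h : n.totient ≤ 16) :
    n ≤ 51 := by
  have hlt : n < 257 := by nlinarith [Nat.le_totient_sq_of_odd hn]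
  have key : ∀ m < 257, Odd m → m.totient ≤ 16 → m ≤ 51 := by decide +kernel
  exact key n hlt hn h

open Polynomial in
/-- If `q ^ 2` is a primitive `n`-th root of unity, `n` does not divide `4`, and
`[13]_q[8]_q/[4]_q` is an integer, then `φ(n) ≤ 16`. -/
theorem totient_le_of_qint_eq_intCast {n : ℕ} (hn : 0 < n) (hn4 : ¬ n ∣ 4) {q : ℂ}
    (hw : IsPrimitiveRoot (q ^ 2) n) {k : ℤ}
    (hk : qint q 13 * qint q 8 / qint q 4 = (k : ℂ)) : n.totient ≤ 16 := by
  have hq0 : q ≠ 0 := by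
    rintro rfl
    exact hw.ne_zero hn.ne' (by simp)
  have h8 : q ^ 8 - 1 ≠ 0 := fun h => hn4 <| (hw.pow_eq_one_iff_dvd 4).1 <| by
    linear_combination h
  have h2 : q ^ 2 - 1 ≠ 0 := fun h => h8 <| by
    linear_combination (q ^ 6 + q ^ 4 + q ^ 2 + 1) * h
  have hqint (m : ℕ) : qint q m = (q ^ (2 * m) - 1) / q ^ m * (q / (q ^ 2 - 1)) := by
    have hu : q - q⁻¹ ≠ 0 := fun h => h2 <| by
      field_simp at h
      simpa using h
    rw [qint, zpow_neg, zpow_natCast]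
    field_simp
    ring
  have hprod : (q ^ 26 - 1) * (q ^ 16 - 1) = k * q ^ 16 * ((q ^ 8 - 1) * (q ^ 2 - 1)) := by
    rw [hqint, hqint, hqint] at hk
    norm_num at hk
    field_simp at hk
    linear_combination hk
  have hroot : (∑ i ∈ Finset.range 13, (q ^ 2) ^ i) * ((q ^ 2) ^ 4 + 1) - k * (q ^ 2) ^ 8 = 0 := by
    refine (mul_eq_zero.1 ?_).resolve_right (mul_ne_zero h8 h2)
    simp only [Finset.sum_range_succ, Finset.sum_range_zero]
    linear_combination hprod
  let p : ℤ[X] := (∑ i ∈ Finset.range 13, X ^ i) * (X ^ 4 + 1) - C k * X ^ 8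
  have hp : p ≠ 0 := fun h => by
    have := congrArg (eval 0) h
    simp [p, Finset.sum_range_succ] at this
  have hdeg : p.natDegree ≤ 16 := by
    simp only [p, Finset.sum_range_succ, Finset.sum_range_zero]
    compute_degree
  refine (hw.totient_le_natDegree_of_aeval_eq_zero hn hp ?_).trans hdeg
  simpa [p] using hroot

/-- For odd `ℓ ≥ 5` and `q = e^{iπ/ℓ}`, if `[13]_q[8]_q/[4]_q` is a rational
integer then `ℓ ≤ 51`. -/
theorem stmt_8 (ℓ : ℕ) (hℓ : 5 ≤ ℓ) (hodd : Odd ℓ)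
    (q : ℂ) (hq : q = Complex.exp (Real.pi * Complex.I / (ℓ : ℂ)))
    (k : ℤ) (hk : qint q 13 * qint q 8 / qint q 4 = (k : ℂ)) :
    ℓ ≤ 51 := by
  have hw : IsPrimitiveRoot (q ^ 2) ℓ := by
    have h := Complex.isPrimitiveRoot_exp ℓ (by omega)
    rwa [hq, ← Complex.exp_nat_mul, show ((2 : ℕ) : ℂ) * (Real.pi * Complex.I / (ℓ : ℂ)) =
      2 * Real.pi * Complex.I / ℓ by push_cast; ring]
  refine Nat.le_of_odd_of_totient_le_sixteen hodd
    (totient_le_of_qint_eq_intCast (by omega) (fun h => ?_) hw hk)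
  have := Nat.le_of_dvd (by norm_num) h
  omega
end
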